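/- For every i ≥ 1, the i-th order silver stepsize schedule s̄_i is a primitive schedule of length 2^i − 1, and for every i ≥ 0 the sum of its entries equals ρ^i − 1, where ρ = 1 + √2. -/

import Mathlib

open Finset
open scoped RealInnerProductSpace

noncomputable section

/-- Gradient-descent trajectory along a finite list of stepsizes. -/
def gdIter {E : Type*} [AddCommGroup E] [SMul ℝ E] (g : E → E) : E → List ℝ → E
  | x, [] => x
  | x, a :: L => gdIter g (x - a • g x) L

/-- A finite stepsize schedule (of positive reals) is primitive if the key
gradient-descent inequality holds for every smooth convex problem instance. -/
def IsPrimitive (L : List ℝ) : Prop :=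
  (∀ a ∈ L, (0:ℝ) < a) ∧
  ∀ (d : ℕ) (f : EuclideanSpace ℝ (Fin d) → ℝ)
    (g : EuclideanSpace ℝ (Fin d) → EuclideanSpace ℝ (Fin d)),
    ConvexOn ℝ Set.univ f →
    (∀ y, HasGradientAt f (g y) y) →
    LipschitzWith 1 g →
    ∀ xstar : EuclideanSpace ℝ (Fin d), IsMinOn f Set.univ xstar →
    ∀ x1 : EuclideanSpace ℝ (Fin d),
      L.sum * (f (gdIter g x1 L) - f xstar)
        + (L.sum * (L.sum + 1) / 2) * ‖g (gdIter g x1 L)‖ ^ 2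
        + 2⁻¹ * ‖gdIter g x1 L - xstar‖ ^ 2
      ≤ 2⁻¹ * ‖x1 - xstar‖ ^ 2
        + ∑ i : Fin L.length,
            L.get i *
              (f (gdIter g x1 (L.take i.1)) - f xstar
                - ⟪g (gdIter g x1 (L.take i.1)), gdIter g x1 (L.take i.1) - xstar⟫
                + 2⁻¹ * ‖g (gdIter g x1 (L.take i.1))‖ ^ 2)

/-- The join-stepsize function. -/
def phi (x y : ℝ) : ℝ :=
  (-(x + y) + Real.sqrt ((x + y + 2) ^ 2 + 4 * (x + 1) * (y + 1))) / 2

/-- Concatenation of two stepsize schedules with the join stepsize in between. -/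
def concatSched (s r : List ℝ) : List ℝ := s ++ phi s.sum r.sum :: r

/-- The silver stepsize schedules. -/
def silver : ℕ → List ℝ
  | 0 => []
  | i + 1 => concatSched (silver i) (silver i)

/-- Recursive concatenation of a sequence of schedules. -/
def concatAll (s : ℕ → List ℝ) : ℕ → List ℝ
  | 0 => []
  | i + 1 => concatSched (concatAll s i) (s (i + 1))

/-- The number of copies of the `j`-th silver schedule. -/
def kSeq (c : ℝ) (j : ℕ) : ℕ := ⌊2 * (2:ℝ) ^ (c * j)⌋₊

def MSeq (c : ℝ) (j : ℕ) : ℕ := ∑ j' ∈ Finset.Icc 1 j, kSeq c j'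

/-- The block index `j` of `i`, i.e. the `j` with `M_{j-1} < i ≤ M_j`. -/
def blockIdx (c : ℝ) (i : ℕ) : ℕ := sInf {j | i ≤ MSeq c j}

/-- The partially concatenated schedules `ŝ_i`. -/
def shatSched (c : ℝ) : ℕ → List ℝ := concatAll fun i => silver (blockIdx c i)

/-- The `t`-th entry (1-indexed) of the infinite limiting schedule `ŝ`. -/
def shatEntry (c : ℝ) (t : ℕ) : ℝ := (shatSched c t).getD (t - 1) 0

section SmoothConvex

variable {E : Type*} [NormedAddCommGroup E] [InnerProductSpace ℝ E]

/-- The interpolation inequality satisfied by a convex function `f` with `1`-Lipschitz gradient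
`g`. -/
def Interpolates (f : E → ℝ) (g : E → E) : Prop :=
  ∀ x y, f x + ⟪g x, y - x⟫ + 2⁻¹ * ‖g y - g x‖ ^ 2 ≤ f y

theorem hasDerivAt_comp_line [CompleteSpace E] {f : E → ℝ} {g : E → E}
    (hf : ∀ y, HasGradientAt f (g y) y) (x v : E) (t : ℝ) :
    HasDerivAt (fun s : ℝ => f (x + s • v)) ⟪g (x + t • v), v⟫ t := by
  have hline : HasDerivAt (fun s : ℝ => x + s • v) v t := by
    simpa using ((hasDerivAt_id t).smul_const v).const_add x
  refine ((hf (x + t • v)).hasFDerivAt.comp_hasDerivAt t hline).congr_deriv ?_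
  simp

theorem ConvexOn.add_inner_le_of_hasGradientAt [CompleteSpace E] {f : E → ℝ} {g : E → E}
    (hconv : ConvexOn ℝ Set.univ f) (hf : ∀ y, HasGradientAt f (g y) y) (x y : E) :
    f x + ⟪g x, y - x⟫ ≤ f y := by
  have hline : ConvexOn ℝ Set.univ (fun s : ℝ => f (x + s • (y - x))) := by
    have h := hconv.comp_affineMap (AffineMap.lineMap x y : ℝ →ᵃ[ℝ] E)
    simpa [Function.comp_def, AffineMap.lineMap_apply, add_comm] using h
  have hd := hasDerivAt_comp_line hf x (y - x) 0
  have h := hline.le_slope_of_hasDerivAt (Set.mem_univ 0) (Set.mem_univ 1) one_pos hd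
  simp [slope_def_field] at h
  linarith

theorem le_add_inner_add_sq_of_lipschitzWith [CompleteSpace E] {f : E → ℝ} {g : E → E}
    (hf : ∀ y, HasGradientAt f (g y) y) (hg : LipschitzWith 1 g) (x v : E) :
    f (x + v) ≤ f x + ⟪g x, v⟫ + 2⁻¹ * ‖v‖ ^ 2 := by
  have hd : ∀ t : ℝ, HasDerivAt
      (fun s : ℝ => f (x + s • v) - (s * ⟪g x, v⟫ + 2⁻¹ * ‖v‖ ^ 2 * s ^ 2))
      (⟪g (x + t • v), v⟫ - (⟪g x, v⟫ + ‖v‖ ^ 2 * t)) t := by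
    intro t
    refine (hasDerivAt_comp_line hf x v t).sub ?_
    refine (((hasDerivAt_id t).mul_const ⟪g x, v⟫).add
      (((hasDerivAt_id t).pow 2).const_mul (2⁻¹ * ‖v‖ ^ 2))).congr_deriv ?_
    simp
    ring
  have hanti : AntitoneOn
      (fun s : ℝ => f (x + s • v) - (s * ⟪g x, v⟫ + 2⁻¹ * ‖v‖ ^ 2 * s ^ 2)) (Set.Icc 0 1) := by
    refine antitoneOn_of_deriv_nonpos (convex_Icc 0 1)
      (fun t _ => (hd t).continuousAt.continuousWithinAt)
      (fun t _ => (hd t).differentiableAt.differentiableWithinAt) fun t ht => ?_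
    rw [(hd t).deriv]
    rw [interior_Icc] at ht
    have hlip : ‖g (x + t • v) - g x‖ ≤ t * ‖v‖ := by
      simpa [dist_eq_norm, norm_smul, abs_of_pos ht.1] using hg.dist_le_mul (x + t • v) x
    have hcs := real_inner_le_norm (g (x + t • v) - g x) v
    rw [inner_sub_left] at hcs
    nlinarith [mul_le_mul_of_nonneg_right hlip (norm_nonneg v)]
  have h := hanti (Set.left_mem_Icc.2 zero_le_one) (Set.right_mem_Icc.2 zero_le_one) zero_le_one
  simp at h
  linarith

theorem ConvexOn.interpolates [CompleteSpace E] {f : E → ℝ} {g : E → E}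
    (hconv : ConvexOn ℝ Set.univ f) (hf : ∀ y, HasGradientAt f (g y) y)
    (hg : LipschitzWith 1 g) : Interpolates f g := by
  intro x y
  have h₁ := hconv.add_inner_le_of_hasGradientAt hf x (y + -(g y - g x))
  have h₂ := le_add_inner_add_sq_of_lipschitzWith hf hg y (-(g y - g x))
  rw [norm_neg, inner_neg_right] at h₂
  rw [show y + -(g y - g x) - x = (y - x) - (g y - g x) by abel, inner_sub_right] at h₁
  have h₃ : ⟪g y, g y - g x⟫ - ⟪g x, g y - g x⟫ = ‖g y - g x‖ ^ 2 := by
    rw [← inner_sub_left, real_inner_self_eq_norm_sq]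
  linarith

/-- The sum of the values of `h` along a gradient-descent trajectory, weighted by the stepsizes. -/
def gdSum (g : E → E) (h : E → ℝ) : E → List ℝ → ℝ
  | _, [] => 0
  | x, a :: L => a * h x + gdSum g h (x - a • g x) L

theorem gdIter_append (g : E → E) (x : E) (s r : List ℝ) :
    gdIter g x (s ++ r) = gdIter g (gdIter g x s) r := by
  induction s generalizing x with
  | nil => rfl
  | cons a s ih => exact ih _

theorem gdSum_append (g : E → E) (h : E → ℝ) (x : E) (s r : List ℝ) :
    gdSum g h x (s ++ r) = gdSum g h x s + gdSum g h (gdIter g x s) r := by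
  induction s generalizing x with
  | nil => simp [gdSum, gdIter]
  | cons a s ih => simp [gdSum, gdIter, ih, add_assoc]

theorem gdSum_mono (g : E → E) {h k : E → ℝ} (hk : ∀ x, h x ≤ k x) {L : List ℝ}
    (hL : ∀ a ∈ L, 0 < a) (x : E) : gdSum g h x L ≤ gdSum g k x L := by
  induction L generalizing x with
  | nil => exact le_rfl
  | cons a L ih =>
    rw [List.forall_mem_cons] at hL
    exact add_le_add (mul_le_mul_of_nonneg_left (hk x) hL.1.le) (ih hL.2 _)

theorem gdSum_const_add_inner (g : E → E) (c : ℝ) (v x : E) (L : List ℝ) :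
    gdSum g (fun y => c + ⟪v, g y⟫) x L = L.sum * c + ⟪v, x - gdIter g x L⟫ := by
  induction L generalizing x with
  | nil => simp [gdSum, gdIter]
  | cons a L ih =>
    simp only [gdSum, gdIter, ih, List.sum_cons, inner_sub_right, inner_smul_right]
    ring

theorem gdSum_eq_sum (g : E → E) (h : E → ℝ) (x : E) (L : List ℝ) :
    gdSum g h x L = ∑ i : Fin L.length, L.get i * h (gdIter g x (L.take i.1)) := by
  induction L generalizing x with
  | nil => simp [gdSum]
  | cons a L ih => simp [gdSum, gdIter, ih, Fin.sum_univ_succ]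

/-- The primitivity inequality along the schedule `L`, started at `x`, with an arbitrary
reference point `p` and reference value `c`. -/
def PrimitiveBound (f : E → ℝ) (g : E → E) (L : List ℝ) : Prop :=
  ∀ (x p : E) (c : ℝ),
    L.sum * (f (gdIter g x L) - c)
        + (L.sum * (L.sum + 1) / 2) * ‖g (gdIter g x L)‖ ^ 2
        + 2⁻¹ * ‖gdIter g x L - p‖ ^ 2
      ≤ 2⁻¹ * ‖x - p‖ ^ 2
        + gdSum g (fun y => f y - c - ⟪g y, y - p⟫ + 2⁻¹ * ‖g y‖ ^ 2) x L

/-- Bounding the weighted sum in the primitivity inequality by interpolation against the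
reference point. -/
theorem PrimitiveBound.le_of_interpolates {f : E → ℝ} {g : E → E} {L : List ℝ}
    (h : PrimitiveBound f g L) (hfg : Interpolates f g) (hL : ∀ a ∈ L, 0 < a) (x q : E) :
    L.sum * (f (gdIter g x L) - f q)
        + (L.sum * (L.sum + 1) / 2) * ‖g (gdIter g x L)‖ ^ 2
        + 2⁻¹ * ‖gdIter g x L - q‖ ^ 2
      ≤ 2⁻¹ * ‖x - q‖ ^ 2 - L.sum / 2 * ‖g q‖ ^ 2 + ⟪g q, x - gdIter g x L⟫ := by
  have hmono := gdSum_mono g (h := fun y => f y - f q - ⟪g y, y - q⟫ + 2⁻¹ * ‖g y‖ ^ 2)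
    (k := fun y => -(2⁻¹ * ‖g q‖ ^ 2) + ⟪g q, g y⟫) (fun y => by
      have hy := hfg y q
      rw [← neg_sub y q, inner_neg_right, norm_sub_sq_real] at hy
      linarith) hL x
  rw [gdSum_const_add_inner] at hmono
  linarith [h x q (f q)]

end SmoothConvex

theorem add_phi_mul_add_phi {x y : ℝ} (hx : 0 ≤ x) (hy : 0 ≤ y) :
    (x + phi x y) * (y + phi x y) = 2 * (x + 1) * (y + 1) := by
  have h := Real.sq_sqrt (show 0 ≤ (x + y + 2) ^ 2 + 4 * (x + 1) * (y + 1) by positivity)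
  unfold phi
  linear_combination h / 4

theorem one_lt_phi {x y : ℝ} (hx : 0 ≤ x) (hy : 0 ≤ y) : 1 < phi x y := by
  have h : x + y + 2 < Real.sqrt ((x + y + 2) ^ 2 + 4 * (x + 1) * (y + 1)) :=
    Real.lt_sqrt_of_sq_lt (lt_add_of_pos_right _ (by positivity))
  unfold phi
  linarith

/-- Combination of the interpolation inequalities between the points before and after the second
schedule of a concatenation with the two bounds `h₁`, `h₂` for that schedule. Here `F` is the
difference of the function values, and the remaining variables are the inner products of the
displacement `w` and of the two gradients `G`, `H`. -/
theorem join_step_bound {A B α F ww wG wH GG GH HH : ℝ} (hB : 0 ≤ B) (hA : 0 ≤ A) (hα : 1 < α)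
    (hjoin : (A + α) * (B + α) = 2 * (A + 1) * (B + 1))
    (h₁ : B * F + (B * (B + 1) / 2) * HH + 2⁻¹ * ww
      ≤ 2⁻¹ * (α ^ 2 * GG) - B / 2 * GG + (-wG - α * GG))
    (h₂ : (B * (B + 1) / 2) * HH
      ≤ 2⁻¹ * (ww + 2 * (α * wG) + α ^ 2 * GG) - B / 2 * HH + (-wH - α * GH))
    (h₃ : F - wH + 2⁻¹ * (GG - 2 * GH + HH) ≤ 0)
    (h₄ : wG + 2⁻¹ * (GG - 2 * GH + HH) ≤ F) :
    (A + α) * F + ((A + α + B) * (A + α + B + 1) / 2 - B * (B + 1) / 2) * HH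
      ≤ (A * (A + 1) / 2 + α / 2 - α ^ 2 / 2) * GG := by
  have hlt : 0 < B + 2 - α := by nlinarith
  obtain ⟨c, hc⟩ : ∃ c, c * (B + 2 - α) = A + α := ⟨(A + α) / (B + 2 - α), by field_simp⟩
  have hc0 : 0 < c := pos_of_mul_pos_left (hc ▸ by linarith) hlt.le
  have hHH : c * ((2 * B + 1) * (B + 1) + (α - 1))
      = (A + α + B) * (A + α + B + 1) - B * (B + 1) := by
    refine mul_right_cancel₀ hlt.ne' ?_
    linear_combination ((2 * B + 1) * (B + 1) + (α - 1)) * hc + (A + α) * hjoin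
  have hGG : c * (2 * (α - 1) ^ 2 + (α - 1) - (B + 1)) = A * (A + 1) + α - α ^ 2 := by
    refine mul_right_cancel₀ hlt.ne' ?_
    linear_combination (2 * (α - 1) ^ 2 + (α - 1) - (B + 1)) * hc + (A + α) * hjoin
  have h₁₂ := mul_le_mul_of_nonneg_left (add_le_add (add_le_add h₁ h₂) h₃) hc0.le
  have h₄' := mul_le_mul_of_nonneg_left h₄ (mul_nonneg hc0.le (sub_nonneg.2 hα.le))
  linear_combination h₁₂ + h₄' - F * hc - HH / 2 * hHH + GG / 2 * hGG

section Concat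

variable {E : Type*} [NormedAddCommGroup E] [InnerProductSpace ℝ E]

theorem PrimitiveBound.concatSched {f : E → ℝ} {g : E → E} {s r : List ℝ}
    (hs : PrimitiveBound f g s) (hr : PrimitiveBound f g r) (hfg : Interpolates f g)
    (hs0 : ∀ a ∈ s, 0 < a) (hr0 : ∀ a ∈ r, 0 < a) : PrimitiveBound f g (concatSched s r) := by
  intro x p c
  have hA : 0 ≤ s.sum := List.sum_nonneg fun a ha => (hs0 a ha).le
  have hB : 0 ≤ r.sum := List.sum_nonneg fun a ha => (hr0 a ha).le
  have hα := one_lt_phi hA hB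
  have hjoin := add_phi_mul_add_phi hA hB
  simp only [_root_.concatSched, gdIter_append, gdSum_append, List.sum_append, List.sum_cons,
    gdIter, gdSum]
  have hx := hs x p c
  set y := gdIter g x s
  set α := phi s.sum r.sum
  have hz := hr (y - α • g y) p c
  have hy := hr.le_of_interpolates hfg hr0 (y - α • g y) y
  have hw := hr.le_of_interpolates hfg hr0 (y - α • g y) (gdIter g (y - α • g y) r)
  set w := gdIter g (y - α • g y) r
  have h₁ := hfg w y
  have h₂ := hfg y w
  have key := join_step_bound (F := f w - f y) (ww := ‖w - y‖ ^ 2) (wG := ⟪g y, w - y⟫)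
    (wH := ⟪g w, w - y⟫) (GG := ‖g y‖ ^ 2) (GH := ⟪g w, g y⟫) (HH := ‖g w‖ ^ 2)
    hB hA hα hjoin ?_ ?_ ?_ ?_
  · have hnorm : ‖y - α • g y - p‖ ^ 2
        = ‖y - p‖ ^ 2 - 2 * (α * ⟪g y, y - p⟫) + α ^ 2 * ‖g y‖ ^ 2 := by
      rw [sub_right_comm, norm_sub_sq_real, inner_smul_right, norm_smul, mul_pow,
        Real.norm_eq_abs, sq_abs, real_inner_comm]
    rw [hnorm] at hz
    linear_combination hx + hz + key
  · rw [show y - α • g y - y = -(α • g y) by abel,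
      show y - α • g y - w = -(w - y) - α • g y by abel, norm_neg, norm_smul, mul_pow,
      Real.norm_eq_abs, sq_abs, inner_sub_right, inner_neg_right, inner_smul_right,
      real_inner_self_eq_norm_sq] at hy
    exact hy
  · rw [show y - α • g y - w = -((w - y) + α • g y) by abel, norm_neg, norm_add_sq_real,
      norm_smul, mul_pow, Real.norm_eq_abs, sq_abs, inner_neg_right, inner_add_right,
      inner_smul_right, inner_smul_right, real_inner_comm, sub_self, sub_self, norm_zero] at hw
    linear_combination hw
  · rw [← neg_sub w y, inner_neg_right, norm_sub_sq_real, real_inner_comm (g w) (g y)] at h₁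
    linear_combination h₁
  · rw [norm_sub_sq_real] at h₂
    linear_combination h₂

end Concat

theorem silver_pos (i : ℕ) : ∀ a ∈ silver i, 0 < a := by
  induction i with
  | zero => simp [silver]
  | succ i ih =>
    have h0 : 0 ≤ (silver i).sum := List.sum_nonneg fun a ha => (ih a ha).le
    have hphi := one_lt_phi h0 h0
    intro a ha
    simp only [silver, concatSched, List.mem_append, List.mem_cons] at ha
    rcases ha with ha | rfl | ha
    · exact ih a ha
    · linarith
    · exact ih a ha

theorem silver_primitiveBound {E : Type*} [NormedAddCommGroup E] [InnerProductSpace ℝ E]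
    {f : E → ℝ} {g : E → E} (hfg : Interpolates f g) (i : ℕ) : PrimitiveBound f g (silver i) := by
  induction i with
  | zero => intro x p c; simp [silver, gdIter, gdSum]
  | succ i ih => exact ih.concatSched ih hfg (silver_pos i) (silver_pos i)

theorem isPrimitive_silver (i : ℕ) : IsPrimitive (silver i) := by
  refine ⟨silver_pos i, fun d f g hconv hf hg xstar _ x1 => ?_⟩
  have h := silver_primitiveBound (hconv.interpolates hf hg) i x1 xstar (f xstar)
  rwa [gdSum_eq_sum] at h

theorem length_silver (i : ℕ) : (silver i).length = 2 ^ i - 1 := by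
  induction i with
  | zero => rfl
  | succ i ih =>
    have h := Nat.one_le_two_pow (n := i)
    simp only [silver, concatSched, List.length_append, List.length_cons, ih, pow_succ]
    omega

theorem phi_self {x : ℝ} (hx : 0 ≤ x) : phi x x = (x + 1) * Real.sqrt 2 - x := by
  have h : Real.sqrt ((x + x + 2) ^ 2 + 4 * (x + 1) * (x + 1)) = 2 * (x + 1) * Real.sqrt 2 := by
    rw [Real.sqrt_eq_iff_mul_self_eq (by positivity) (by positivity)]
    linear_combination -4 * (x + 1) ^ 2 * Real.sq_sqrt (zero_le_two (α := ℝ))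
  rw [phi, h]
  ring

theorem sum_silver (i : ℕ) : (silver i).sum = (1 + Real.sqrt 2) ^ i - 1 := by
  induction i with
  | zero => simp [silver]
  | succ i ih =>
    have h0 : 0 ≤ (silver i).sum := List.sum_nonneg fun a ha => (silver_pos i a ha).le
    simp only [silver, concatSched, List.sum_append, List.sum_cons]
    rw [phi_self h0, ih]
    ring

/-- for `i ≥ 1` the `i`-th silver schedule is primitive of length
`2^i − 1`, and for all `i ≥ 0` its entries sum to `ρ^i − 1` with `ρ = 1 + √2`. -/
theorem silver_primitive_length_sum :
    (∀ i : ℕ, 1 ≤ i → IsPrimitive (silver i) ∧ (silver i).length = 2 ^ i - 1) ∧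
    (∀ i : ℕ, (silver i).sum = (1 + Real.sqrt 2) ^ i - 1) :=
  ⟨fun i _ => ⟨isPrimitive_silver i, length_silver i⟩, sum_silver⟩
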